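/- arXiv:1510.03459 — 3 statements merged into one kernel-verified Lean document; each statement's English description precedes it below -/
import Mathlib

section
/- Let 0 < q < 1, let x > 0, y > 0, and let α ≥ 1 satisfy ψ_q(α) ≥ 0 (i.e., α is at least the unique positive root of ψ_q). Then e^{y−x} · ((x+α)/(y+α)) · (x/y)^{y((y+α−1)/(y+α) + ψ_q(y+α))} ≤ Γ_q(x+α)/Γ_q(y+α) ≤ e^{y−x} · ((x+α)/(y+α)) · (x/y)^{x((x+α−1)/(x+α) + ψ_q(x+α))}. -/
/-- The `q`-extension of the Gamma function: for fixed `q ∈ (0,1)` and `x > 0`,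
`Γ_q(x) = (1-q)^{1-x} ∏_{n=0}^∞ (1-q^{n+1})/(1-q^{n+x})`. -/
noncomputable def qGamma (q x : ℝ) : ℝ :=
  (1 - q) ^ (1 - x) * ∏' n : ℕ, (1 - q ^ (n + 1)) / (1 - q ^ ((n : ℝ) + x))

/-- The `q`-extension of the digamma function:
`ψ_q(x) = -ln(1-q) + (ln q) ∑_{n=1}^∞ q^{n x}/(1-q^n)`. -/
noncomputable def qDigamma (q x : ℝ) : ℝ :=
  -Real.log (1 - q) + Real.log q * ∑' n : ℕ, q ^ (((n : ℝ) + 1) * x) / (1 - q ^ (n + 1))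

lemma summable_rpow_natCast_add {q : ℝ} (hq0 : 0 < q) (hq1 : q < 1) (x : ℝ) :
    Summable fun n : ℕ => q ^ ((n : ℝ) + x) := by
  simp_rw [Real.rpow_add hq0, Real.rpow_natCast]
  exact (summable_geometric_of_lt_one hq0.le hq1).mul_right _

lemma one_sub_rpow_natCast_add_pos {q x : ℝ} (hq0 : 0 < q) (hq1 : q < 1) (hx : 0 < x) (n : ℕ) :
    0 < 1 - q ^ ((n : ℝ) + x) :=
  sub_pos.2 (Real.rpow_lt_one hq0.le hq1 (by positivity))

lemma summable_log_one_sub_rpow {q : ℝ} (hq0 : 0 < q) (hq1 : q < 1) (x : ℝ) :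
    Summable fun n : ℕ => Real.log (1 - q ^ ((n : ℝ) + x)) := by
  have h := Real.summable_log_one_add_of_summable (summable_rpow_natCast_add hq0 hq1 x).neg
  simpa [sub_eq_add_neg] using h

lemma qGamma_eq_exp {q x : ℝ} (hq0 : 0 < q) (hq1 : q < 1) (hx : 0 < x) :
    qGamma q x = Real.exp (Real.log (1 - q) * (1 - x) +
      (∑' n : ℕ, Real.log (1 - q ^ ((n : ℝ) + 1)) -
        ∑' n : ℕ, Real.log (1 - q ^ ((n : ℝ) + x)))) := by
  have h1 := summable_log_one_sub_rpow hq0 hq1 1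
  have h2 := summable_log_one_sub_rpow hq0 hq1 x
  have hcast : ∀ n : ℕ, q ^ (n + 1) = q ^ ((n : ℝ) + 1) := fun n => by
    exact_mod_cast (Real.rpow_natCast q (n + 1)).symm
  have hp1 := one_sub_rpow_natCast_add_pos hq0 hq1 one_pos
  have hp2 := one_sub_rpow_natCast_add_pos hq0 hq1 hx
  have hlog : ∀ n : ℕ, Real.log ((1 - q ^ (n + 1)) / (1 - q ^ ((n : ℝ) + x))) =
      Real.log (1 - q ^ ((n : ℝ) + 1)) - Real.log (1 - q ^ ((n : ℝ) + x)) := fun n => by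
    rw [hcast, Real.log_div (hp1 n).ne' (hp2 n).ne']
  rw [qGamma, Real.exp_add, ← h1.tsum_sub h2, Real.rpow_def_of_pos (sub_pos.2 hq1)]
  congr 1
  rw [← Real.rexp_tsum_eq_tprod]
  · simp_rw [hlog]
  · intro n
    rw [hcast]
    exact div_pos (hp1 n) (hp2 n)
  · simp_rw [hlog]
    exact h1.sub h2

lemma summable_rpow_mul_prod {q x : ℝ} (hq0 : 0 < q) (hq1 : q < 1) (hx : 0 < x) :
    Summable fun p : ℕ × ℕ => q ^ (((p.2 : ℝ) + 1) * ((p.1 : ℝ) + x)) := by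
  have h1 := summable_geometric_of_lt_one hq0.le hq1
  have h2 := summable_geometric_of_lt_one (Real.rpow_nonneg hq0.le x)
    (Real.rpow_lt_one hq0.le hq1 hx)
  refine Summable.of_nonneg_of_le (fun p => by positivity) (fun p => ?_)
    (h1.mul_of_nonneg h2 (fun n => by positivity) (fun n => by positivity))
  rw [← Real.rpow_natCast, ← Real.rpow_natCast, ← Real.rpow_mul hq0.le, ← Real.rpow_add hq0]
  apply Real.rpow_le_rpow_of_exponent_ge hq0 hq1.le
  have : (0 : ℝ) ≤ p.1 * p.2 := by positivity
  nlinarith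

lemma hasSum_rpow_mul_left {q x : ℝ} (hq0 : 0 < q) (hq1 : q < 1) (hx : 0 < x) (n : ℕ) :
    HasSum (fun k : ℕ => q ^ (((k : ℝ) + 1) * ((n : ℝ) + x)))
      (q ^ ((n : ℝ) + x) / (1 - q ^ ((n : ℝ) + x))) := by
  have h := (hasSum_geometric_of_lt_one (Real.rpow_nonneg hq0.le ((n : ℝ) + x))
    (Real.rpow_lt_one hq0.le hq1 (by positivity))).mul_left (q ^ ((n : ℝ) + x))
  rw [div_eq_mul_inv]
  refine h.congr_fun ?_
  intro k
  rw [← Real.rpow_natCast, ← Real.rpow_mul hq0.le, ← Real.rpow_add hq0]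
  congr 1
  ring

lemma hasSum_rpow_mul_right {q : ℝ} (hq0 : 0 < q) (hq1 : q < 1) (x : ℝ) (k : ℕ) :
    HasSum (fun n : ℕ => q ^ (((k : ℝ) + 1) * ((n : ℝ) + x)))
      (q ^ (((k : ℝ) + 1) * x) / (1 - q ^ (k + 1))) := by
  have h := (hasSum_geometric_of_lt_one (pow_nonneg hq0.le (k + 1))
    (pow_lt_one₀ hq0.le hq1 k.succ_ne_zero)).mul_left (q ^ (((k : ℝ) + 1) * x))
  rw [div_eq_mul_inv]
  refine h.congr_fun ?_
  intro n
  rw [← pow_mul, ← Real.rpow_natCast, ← Real.rpow_add hq0]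
  congr 1
  push_cast
  ring

lemma hasSum_qDigamma_series {q x : ℝ} (hq0 : 0 < q) (hq1 : q < 1) (hx : 0 < x) :
    HasSum (fun n : ℕ => q ^ ((n : ℝ) + x) / (1 - q ^ ((n : ℝ) + x)))
      (∑' k : ℕ, q ^ (((k : ℝ) + 1) * x) / (1 - q ^ (k + 1))) := by
  have h := summable_rpow_mul_prod hq0 hq1 hx
  have h1 := h.hasSum.prod_fiberwise (hasSum_rpow_mul_left hq0 hq1 hx)
  have h2 := ((Equiv.prodComm ℕ ℕ).hasSum_iff.2 h.hasSum).prod_fiberwise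
    (hasSum_rpow_mul_right hq0 hq1 x)
  rwa [h2.tsum_eq]

lemma qDigamma_mono {q x y : ℝ} (hq0 : 0 < q) (hq1 : q < 1) (hx : 0 < x) (hxy : x ≤ y) :
    qDigamma q x ≤ qDigamma q y := by
  have hs : ∀ z : ℝ, 0 < z →
      Summable fun k : ℕ => q ^ (((k : ℝ) + 1) * z) / (1 - q ^ (k + 1)) := fun z hz =>
    ((summable_rpow_mul_prod hq0 hq1 hz).prod_symm.hasSum.prod_fiberwise
      (hasSum_rpow_mul_right hq0 hq1 z)).summable
  unfold qDigamma
  refine add_le_add_right ?_ _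
  refine mul_le_mul_of_nonpos_left ?_ (Real.log_neg hq0 hq1).le
  refine (hs y (hx.trans_le hxy)).tsum_le_tsum (fun k => ?_) (hs x hx)
  have : 0 < 1 - q ^ (k + 1) := sub_pos.2 (pow_lt_one₀ hq0.le hq1 k.succ_ne_zero)
  refine div_le_div_of_nonneg_right ?_ this.le
  apply Real.rpow_le_rpow_of_exponent_ge hq0 hq1.le
  gcongr

/-- The supporting-line inequality expressing log-convexity of `qGamma`. -/
lemma qGamma_div_le_exp {q x y : ℝ} (hq0 : 0 < q) (hq1 : q < 1) (hx : 0 < x) (hy : 0 < y) :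
    qGamma q x / qGamma q y ≤ Real.exp (qDigamma q x * (x - y)) := by
  rw [qGamma_eq_exp hq0 hq1 hx, qGamma_eq_exp hq0 hq1 hy, ← Real.exp_sub, Real.exp_le_exp]
  have hd := hasSum_qDigamma_series hq0 hq1 hx
  have hsx := (summable_log_one_sub_rpow hq0 hq1 x).hasSum
  have hsy := (summable_log_one_sub_rpow hq0 hq1 y).hasSum
  have key := hasSum_le (fun n : ℕ => ?_) (hsy.sub hsx) (hd.mul_left (Real.log q * (x - y)))
  · unfold qDigamma
    linarith
  · have ha := one_sub_rpow_natCast_add_pos hq0 hq1 hx n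
    have hb := one_sub_rpow_natCast_add_pos hq0 hq1 hy n
    have hab : q ^ ((n : ℝ) + y) =
        q ^ ((n : ℝ) + x) * Real.exp (Real.log q * (y - x)) := by
      rw [← Real.rpow_def_of_pos hq0, ← Real.rpow_add hq0]
      congr 1
      ring
    have hexp := Real.add_one_le_exp (Real.log q * (y - x))
    have hapos : 0 < q ^ ((n : ℝ) + x) := Real.rpow_pos_of_pos hq0 _
    rw [← Real.log_div hb.ne' ha.ne']
    refine (Real.log_le_sub_one_of_pos (div_pos hb ha)).trans ?_
    rw [← mul_div_assoc, div_sub_one ha.ne']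
    refine div_le_div_of_nonneg_right ?_ ha.le
    rw [hab]
    nlinarith

lemma qGamma_pos {q x : ℝ} (hq0 : 0 < q) (hq1 : q < 1) (hx : 0 < x) : 0 < qGamma q x := by
  rw [qGamma_eq_exp hq0 hq1 hx]
  exact Real.exp_pos _

lemma qGamma_shifted_ratio_le {q x y α : ℝ} (hq0 : 0 < q) (hq1 : q < 1)
    (hx : 0 < x) (hy : 0 < y) (hα : 1 ≤ α) (hψ : 0 ≤ qDigamma q α) :
    qGamma q (x + α) / qGamma q (y + α) ≤
      Real.exp (y - x) * ((x + α) / (y + α)) *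
        (x / y) ^ (x * ((x + α - 1) / (x + α) + qDigamma q (x + α))) := by
  have hxα : 0 < x + α := by linarith
  have hyα : 0 < y + α := by linarith
  refine (qGamma_div_le_exp hq0 hq1 hxα hyα).trans ?_
  have hψx : 0 ≤ qDigamma q (x + α) :=
    hψ.trans (qDigamma_mono hq0 hq1 (by linarith) (by linarith))
  rw [Real.rpow_def_of_pos (div_pos hx hy), ← Real.exp_log (div_pos hxα hyα), ← Real.exp_add,
    ← Real.exp_add, Real.exp_le_exp]
  set g := (x + α - 1) / (x + α) + qDigamma q (x + α) with hg
  have hg0 : 0 ≤ g := add_nonneg (div_nonneg (by linarith) hxα.le) hψx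
  have hlog : x - y ≤ x * Real.log (x / y) := by
    have h := Real.one_sub_inv_le_log_of_pos (div_pos hx hy)
    calc x - y = x * (1 - (x / y)⁻¹) := by field_simp
      _ ≤ _ := by gcongr
  have hlogα : (x - y) / (x + α) ≤ Real.log ((x + α) / (y + α)) := by
    have h := Real.one_sub_inv_le_log_of_pos (div_pos hxα hyα)
    calc (x - y) / (x + α) = 1 - ((x + α) / (y + α))⁻¹ := by field_simp; ring
      _ ≤ _ := h
  have hmul := mul_le_mul_of_nonneg_left hlog hg0
  have hsplit : g * (x - y) =
      (x - y) - (x - y) / (x + α) + qDigamma q (x + α) * (x - y) := by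
    rw [hg]
    field_simp
  linarith

theorem qGamma_shifted_ratio_bounds (q x y α : ℝ) (hq0 : 0 < q) (hq1 : q < 1)
    (hx : 0 < x) (hy : 0 < y) (hα : 1 ≤ α) (hψ : 0 ≤ qDigamma q α) :
    Real.exp (y - x) * ((x + α) / (y + α)) *
        (x / y) ^ (y * ((y + α - 1) / (y + α) + qDigamma q (y + α))) ≤
      qGamma q (x + α) / qGamma q (y + α) ∧
    qGamma q (x + α) / qGamma q (y + α) ≤
      Real.exp (y - x) * ((x + α) / (y + α)) *
        (x / y) ^ (x * ((x + α - 1) / (x + α) + qDigamma q (x + α))) := by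
  refine ⟨?_, qGamma_shifted_ratio_le hq0 hq1 hx hy hα hψ⟩
  have hxα : 0 < x + α := by linarith
  have hyα : 0 < y + α := by linarith
  have h := inv_anti₀ (div_pos (qGamma_pos hq0 hq1 hyα) (qGamma_pos hq0 hq1 hxα))
    (qGamma_shifted_ratio_le hq0 hq1 hy hx hα hψ)
  rwa [mul_inv, mul_inv, ← Real.exp_neg, neg_sub, inv_div, inv_div,
    ← Real.inv_rpow (div_pos hy hx).le, inv_div] at h
end

section
/- Let 0 < q < 1 and x > y > 0. Then e^{(x−y)ψ_q(y)} < Γ_q(x)/Γ_q(y) < e^{(x−y)ψ_q(x)}. -/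
open Real in
theorem summable_rpow_succ_mul_div_one_sub_pow {q x : ℝ} (hq0 : 0 < q) (hq1 : q < 1) (hx : 0 < x) :
    Summable fun m : ℕ ↦ q ^ (((m : ℝ) + 1) * x) / (1 - q ^ (m + 1)) := by
  have hgeom : Summable fun m : ℕ ↦ (q ^ x) ^ (m + 1) / (1 - q) :=
    (((summable_geometric_of_lt_one (rpow_nonneg hq0.le x)
      (rpow_lt_one hq0.le hq1 hx)).mul_left (q ^ x)).congr fun m ↦ (pow_succ' _ m).symm).div_const _
  have hpow : ∀ m : ℕ, q ^ (m + 1) ≤ q := fun m ↦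
    pow_le_of_le_one hq0.le hq1.le m.succ_ne_zero
  refine hgeom.of_nonneg_of_le (fun m ↦ ?_) fun m ↦ ?_
  · exact div_nonneg (rpow_nonneg hq0.le _) (by linarith [hpow m])
  · rw [mul_comm, rpow_mul hq0.le, ← Nat.cast_add_one, rpow_natCast]
    exact div_le_div_of_nonneg_left (by positivity) (by linarith) (by linarith [hpow m])

theorem summable_rpow_succ_mul_div_succ_mul_one_sub_pow {q x : ℝ} (hq0 : 0 < q) (hq1 : q < 1)
    (hx : 0 < x) :
    Summable fun m : ℕ ↦ q ^ (((m : ℝ) + 1) * x) / (1 - q ^ (m + 1)) / ((m : ℝ) + 1) := by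
  have hnonneg : ∀ m : ℕ, 0 ≤ q ^ (((m : ℝ) + 1) * x) / (1 - q ^ (m + 1)) := fun m ↦
    div_nonneg (Real.rpow_nonneg hq0.le _) (sub_nonneg.2 (pow_le_one₀ hq0.le hq1.le))
  refine (summable_rpow_succ_mul_div_one_sub_pow hq0 hq1 hx).of_nonneg_of_le
    (fun m ↦ div_nonneg (hnonneg m) (by positivity)) fun m ↦ ?_
  exact div_le_self (hnonneg m) (by linarith [(Nat.cast_nonneg m : (0 : ℝ) ≤ m)])

theorem hasSum_neg_log_one_sub_rpow {q x : ℝ} (hq0 : 0 < q) (hq1 : q < 1) (hx : 0 < x) :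
    HasSum (fun n : ℕ ↦ -Real.log (1 - q ^ ((n : ℝ) + x)))
      (∑' m : ℕ, q ^ (((m : ℝ) + 1) * x) / (1 - q ^ (m + 1)) / ((m : ℝ) + 1)) := by
  set f : ℕ × ℕ → ℝ := fun p ↦ (q ^ ((p.2 : ℝ) + x)) ^ (p.1 + 1) / ((p.1 : ℝ) + 1) with hf
  have hrow : ∀ m : ℕ, HasSum (fun n ↦ f (m, n))
      (q ^ (((m : ℝ) + 1) * x) / (1 - q ^ (m + 1)) / ((m : ℝ) + 1)) := by
    intro m
    have hgeom := ((hasSum_geometric_of_lt_one (by positivity)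
      (pow_lt_one₀ hq0.le hq1 m.succ_ne_zero)).mul_left
        (q ^ (((m : ℝ) + 1) * x))).div_const ((m : ℝ) + 1)
    rw [← div_eq_mul_inv] at hgeom
    refine hgeom.congr_fun fun n ↦ ?_
    simp only [hf, Nat.succ_eq_add_one]
    rw [← Real.rpow_natCast (q ^ _), ← Real.rpow_mul hq0.le, ← pow_mul, ← Real.rpow_natCast q,
      ← Real.rpow_add hq0]
    congr 2
    push_cast
    ring
  have hcol : ∀ n : ℕ, HasSum (fun m ↦ f (m, n)) (-Real.log (1 - q ^ ((n : ℝ) + x))) := by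
    intro n
    have hlt : |q ^ ((n : ℝ) + x)| < 1 := by
      rw [abs_of_pos (Real.rpow_pos_of_pos hq0 _)]
      exact Real.rpow_lt_one hq0.le hq1 (by positivity)
    simpa only [hf] using Real.hasSum_pow_div_log_of_abs_lt_one hlt
  have hsummable : Summable f := by
    rw [summable_prod_of_nonneg fun p ↦ by simp only [hf, Pi.zero_apply]; positivity]
    refine ⟨fun m ↦ (hrow m).summable, ?_⟩
    simpa only [(hrow _).tsum_eq] using summable_rpow_succ_mul_div_succ_mul_one_sub_pow hq0 hq1 hx
  rw [(hsummable.hasSum.prod_fiberwise hrow).tsum_eq]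
  exact ((Equiv.prodComm ℕ ℕ).hasSum_iff.2 hsummable.hasSum).prod_fiberwise hcol

theorem qGamma_eq_rpow_mul_exp {q x : ℝ} (hq0 : 0 < q) (hq1 : q < 1) (hx : 0 < x) :
    qGamma q x = (1 - q) ^ (1 - x) * Real.exp
      ((∑' m : ℕ, q ^ (((m : ℝ) + 1) * x) / (1 - q ^ (m + 1)) / ((m : ℝ) + 1)) -
        ∑' m : ℕ, q ^ (((m : ℝ) + 1) * 1) / (1 - q ^ (m + 1)) / ((m : ℝ) + 1)) := by
  have hprod := ((hasSum_neg_log_one_sub_rpow hq0 hq1 hx).sub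
    (hasSum_neg_log_one_sub_rpow hq0 hq1 one_pos)).rexp
  rw [qGamma, ← hprod.tprod_eq]
  congr 1
  refine tprod_congr fun n ↦ ?_
  have hpos : ∀ z : ℝ, 0 < z → 0 < 1 - q ^ ((n : ℝ) + z) := fun z hz ↦
    sub_pos.2 (Real.rpow_lt_one hq0.le hq1 (by positivity))
  rw [Function.comp_apply, neg_sub_neg, Real.exp_sub, Real.exp_log (hpos 1 one_pos),
    Real.exp_log (hpos x hx), ← Nat.cast_add_one, Real.rpow_natCast]

theorem qGamma_div_qGamma_eq_exp {q x y : ℝ} (hq0 : 0 < q) (hq1 : q < 1) (hx : 0 < x)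
    (hy : 0 < y) :
    qGamma q x / qGamma q y = Real.exp (-(x - y) * Real.log (1 - q) +
      ∑' m : ℕ, (q ^ (((m : ℝ) + 1) * x) / (1 - q ^ (m + 1)) / ((m : ℝ) + 1) -
        q ^ (((m : ℝ) + 1) * y) / (1 - q ^ (m + 1)) / ((m : ℝ) + 1))) := by
  rw [(summable_rpow_succ_mul_div_succ_mul_one_sub_pow hq0 hq1 hx).tsum_sub
      (summable_rpow_succ_mul_div_succ_mul_one_sub_pow hq0 hq1 hy),
    qGamma_eq_rpow_mul_exp hq0 hq1 hx, qGamma_eq_rpow_mul_exp hq0 hq1 hy,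
    Real.rpow_def_of_pos (sub_pos.2 hq1), Real.rpow_def_of_pos (sub_pos.2 hq1),
    ← Real.exp_add, ← Real.exp_add, ← Real.exp_sub]
  congr 1
  ring

theorem rpow_mul_log_mul_lt_rpow_sub_rpow {q a b : ℝ} (hq0 : 0 < q) (hq1 : q < 1) (hab : a ≠ b) :
    q ^ b * (Real.log q * (a - b)) < q ^ a - q ^ b := by
  have hne : Real.log q * (a - b) ≠ 0 :=
    mul_ne_zero (Real.log_neg hq0 hq1).ne (sub_ne_zero.2 hab)
  have hexp := mul_lt_mul_of_pos_left (Real.add_one_lt_exp hne) (Real.rpow_pos_of_pos hq0 b)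
  rw [← Real.rpow_def_of_pos hq0, ← Real.rpow_add hq0, add_sub_cancel] at hexp
  linarith

theorem log_mul_rpow_div_lt_sub {q x y : ℝ} (hq0 : 0 < q) (hq1 : q < 1) (hxy : x ≠ y) (m : ℕ) :
    (x - y) * Real.log q * (q ^ (((m : ℝ) + 1) * y) / (1 - q ^ (m + 1))) <
      q ^ (((m : ℝ) + 1) * x) / (1 - q ^ (m + 1)) / ((m : ℝ) + 1) -
        q ^ (((m : ℝ) + 1) * y) / (1 - q ^ (m + 1)) / ((m : ℝ) + 1) := by
  have hm : (0 : ℝ) < (m : ℝ) + 1 := by positivity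
  have hden : 0 < 1 - q ^ (m + 1) := sub_pos.2 (pow_lt_one₀ hq0.le hq1 m.succ_ne_zero)
  have hlt := rpow_mul_log_mul_lt_rpow_sub_rpow hq0 hq1
    (fun h ↦ hxy (mul_left_cancel₀ hm.ne' h) : ((m : ℝ) + 1) * x ≠ ((m : ℝ) + 1) * y)
  rw [← sub_div, ← sub_div, lt_div_iff₀ hm, mul_div_assoc', div_mul_eq_mul_div]
  refine div_lt_div_of_pos_right (lt_of_eq_of_lt ?_ hlt) hden
  ring

theorem exp_mul_qDigamma_lt_qGamma_div {q x y : ℝ} (hq0 : 0 < q) (hq1 : q < 1) (hx : 0 < x)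
    (hy : 0 < y) (hxy : x ≠ y) :
    Real.exp ((x - y) * qDigamma q y) < qGamma q x / qGamma q y := by
  rw [qGamma_div_qGamma_eq_exp hq0 hq1 hx hy, Real.exp_lt_exp, qDigamma, mul_add, ← mul_assoc,
    mul_neg, ← neg_mul, ← tsum_mul_left]
  gcongr 1
  have hlt := log_mul_rpow_div_lt_sub hq0 hq1 hxy
  exact Summable.tsum_lt_tsum (i := 0) (fun m ↦ (hlt m).le) (hlt 0)
    ((summable_rpow_succ_mul_div_one_sub_pow hq0 hq1 hy).mul_left _)
    ((summable_rpow_succ_mul_div_succ_mul_one_sub_pow hq0 hq1 hx).sub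
      (summable_rpow_succ_mul_div_succ_mul_one_sub_pow hq0 hq1 hy))

theorem qGamma_ratio_exp_bounds (q x y : ℝ) (hq0 : 0 < q) (hq1 : q < 1)
    (hy : 0 < y) (hxy : y < x) :
    Real.exp ((x - y) * qDigamma q y) < qGamma q x / qGamma q y ∧
    qGamma q x / qGamma q y < Real.exp ((x - y) * qDigamma q x) := by
  have hx : 0 < x := hy.trans hxy
  refine ⟨exp_mul_qDigamma_lt_qGamma_div hq0 hq1 hx hy hxy.ne', ?_⟩
  have hlt := exp_mul_qDigamma_lt_qGamma_div hq0 hq1 hy hx hxy.ne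
  have hinv := inv_strictAnti₀ (Real.exp_pos _) hlt
  rwa [inv_div, ← Real.exp_neg, ← neg_mul, neg_sub] at hinv
end

section
/- Let 0 < q < 1 and x > 0. Then ((1−q)/(1−q^x)) · e^{(1/2)ψ_q(x+1/2)} < Γ_q(x)/Γ_q(x+1/2) < ((1−q)/(1−q^x)) · e^{(1/2)ψ_q(x+1)}. -/
open Real

/-- The series `∑_{k ≥ 1} q^{k y} / (k (1 - q^k))`, which equals `-∑_{n ≥ 0} log (1 - q^{n + y})`. -/
noncomputable def qLogSeries (q y : ℝ) : ℝ :=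
  ∑' k : ℕ, q ^ (((k : ℝ) + 1) * y) / (((k : ℝ) + 1) * (1 - q ^ (k + 1)))

lemma rpow_succ_mul_eq_pow {q : ℝ} (hq0 : 0 < q) (y : ℝ) (k : ℕ) :
    q ^ (((k : ℝ) + 1) * y) = (q ^ y) ^ (k + 1) := by
  rw [← rpow_natCast, ← rpow_mul hq0.le]
  congr 1
  push_cast
  ring

lemma hasSum_rpow_add_natCast {q : ℝ} (hq0 : 0 < q) (hq1 : q < 1) (y : ℝ) :
    HasSum (fun n : ℕ => q ^ ((n : ℝ) + y)) (q ^ y / (1 - q)) := by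
  have h := (hasSum_geometric_of_lt_one hq0.le hq1).mul_left (q ^ y)
  rw [← div_eq_mul_inv] at h
  refine h.congr_fun fun n => ?_
  rw [rpow_add hq0, rpow_natCast, mul_comm]

lemma summable_qDigamma {q y : ℝ} (hq0 : 0 < q) (hq1 : q < 1) (hy : 0 < y) :
    Summable (fun n : ℕ => q ^ (((n : ℝ) + 1) * y) / (1 - q ^ (n + 1))) := by
  have hqy : q ^ y < 1 := rpow_lt_one hq0.le hq1 hy
  have hgeom : Summable (fun n : ℕ => (q ^ y) ^ (n + 1) / (1 - q)) :=
    ((summable_nat_add_iff 1).2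
      (summable_geometric_of_lt_one (rpow_nonneg hq0.le y) hqy)).div_const _
  refine hgeom.of_nonneg_of_le (fun n => ?_) (fun n => ?_)
  · have : q ^ (n + 1) < 1 := pow_lt_one₀ hq0.le hq1 (by simp)
    exact div_nonneg (rpow_nonneg hq0.le _) (by linarith)
  · rw [rpow_succ_mul_eq_pow hq0]
    have : q ^ (n + 1) ≤ q := pow_le_of_le_one hq0.le hq1.le (by simp)
    gcongr

lemma hasSum_qLogSeries {q y : ℝ} (hq0 : 0 < q) (hq1 : q < 1) (hy : 0 < y) :
    HasSum (fun k : ℕ => q ^ (((k : ℝ) + 1) * y) / (((k : ℝ) + 1) * (1 - q ^ (k + 1))))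
      (qLogSeries q y) := by
  refine Summable.hasSum ((summable_qDigamma hq0 hq1 hy).of_nonneg_of_le
    (fun n => ?_) (fun n => ?_))
  all_goals
    have : 0 < 1 - q ^ (n + 1) := sub_pos.2 (pow_lt_one₀ hq0.le hq1 (by simp))
  · positivity
  · gcongr
    exact le_mul_of_one_le_left this.le (by simp)

lemma hasSum_neg_log_one_sub_rpow_s6 {q y : ℝ} (hq0 : 0 < q) (hq1 : q < 1) (hy : 0 < y) :
    HasSum (fun n : ℕ => -log (1 - q ^ ((n : ℝ) + y))) (qLogSeries q y) := by
  let f : ℕ × ℕ → ℝ := fun p => (q ^ ((p.1 : ℝ) + y)) ^ (p.2 + 1) / ((p.2 : ℝ) + 1)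
  have hf0 : 0 ≤ f := fun p =>
    div_nonneg (pow_nonneg (rpow_nonneg hq0.le _) _) (by positivity)
  have hrow (n : ℕ) : HasSum (fun k => f (n, k)) (-log (1 - q ^ ((n : ℝ) + y))) := by
    have h : |q ^ ((n : ℝ) + y)| < 1 := by
      rw [abs_of_nonneg (rpow_nonneg hq0.le _)]
      exact rpow_lt_one hq0.le hq1 (by positivity)
    simpa only [f] using hasSum_pow_div_log_of_abs_lt_one h
  have hcol (k : ℕ) : HasSum (fun n => f (n, k))
      (q ^ (((k : ℝ) + 1) * y) / (((k : ℝ) + 1) * (1 - q ^ (k + 1)))) := by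
    have h := (hasSum_rpow_add_natCast (pow_pos hq0 (k + 1))
      (pow_lt_one₀ hq0.le hq1 (by simp)) y).div_const ((k : ℝ) + 1)
    have hcomm (z : ℝ) : (q ^ (k + 1)) ^ z = (q ^ z) ^ (k + 1) := by
      rw [← rpow_natCast q, ← rpow_mul hq0.le, ← rpow_succ_mul_eq_pow hq0]
      push_cast
      rfl
    simp only [hcomm] at h
    rw [rpow_succ_mul_eq_pow hq0, mul_comm ((k : ℝ) + 1), ← div_div]
    simpa only [f] using h
  have hlog : Summable (fun n : ℕ => -log (1 - q ^ ((n : ℝ) + y))) := by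
    simpa only [sub_eq_add_neg] using
      (summable_log_one_add_of_summable
        (hasSum_rpow_add_natCast hq0 hq1 y).summable.neg).neg
  have hf : Summable f := (summable_prod_of_nonneg hf0).2
    ⟨fun n => (hrow n).summable, by simpa only [(hrow _).tsum_eq] using hlog⟩
  have h₁ := hf.hasSum.prod_fiberwise hrow
  have h₂ := ((Equiv.prodComm ℕ ℕ).hasSum_iff.2 hf.hasSum).prod_fiberwise hcol
  rwa [← (hasSum_qLogSeries hq0 hq1 hy).unique h₂] at h₁

lemma qGamma_eq_exp_s6 {q y : ℝ} (hq0 : 0 < q) (hq1 : q < 1) (hy : 0 < y) :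
    qGamma q y = (1 - q) ^ (1 - y) * exp (qLogSeries q y - qLogSeries q 1) := by
  have hpos (z : ℝ) (hz : 0 < z) (n : ℕ) : 0 < 1 - q ^ ((n : ℝ) + z) :=
    sub_pos.2 (rpow_lt_one hq0.le hq1 (by positivity))
  have hterm (n : ℕ) : (1 - q ^ (n + 1)) / (1 - q ^ ((n : ℝ) + y)) =
      (1 - q ^ ((n : ℝ) + 1)) / (1 - q ^ ((n : ℝ) + y)) := by
    rw [← rpow_natCast]
    push_cast
    rfl
  have h : HasSum (fun n : ℕ => log ((1 - q ^ (n + 1)) / (1 - q ^ ((n : ℝ) + y))))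
      (qLogSeries q y - qLogSeries q 1) := by
    refine ((hasSum_neg_log_one_sub_rpow_s6 hq0 hq1 hy).sub
      (hasSum_neg_log_one_sub_rpow_s6 hq0 hq1 one_pos)).congr_fun fun n => ?_
    rw [hterm, log_div (hpos 1 one_pos n).ne' (hpos y hy n).ne']
    ring
  rw [qGamma, ← rexp_tsum_eq_tprod _ h.summable, h.tsum_eq]
  intro n
  rw [hterm]
  exact div_pos (hpos 1 one_pos n) (hpos y hy n)

lemma qLogSeries_sub_qLogSeries_add_one {q x : ℝ} (hq0 : 0 < q) (hq1 : q < 1) (hx : 0 < x) :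
    qLogSeries q x - qLogSeries q (x + 1) = -log (1 - q ^ x) := by
  have h := (hasSum_qLogSeries hq0 hq1 hx).sub
    (hasSum_qLogSeries hq0 hq1 (add_pos hx one_pos))
  refine h.unique ((hasSum_pow_div_log_of_abs_lt_one (x := q ^ x) ?_).congr_fun fun k => ?_)
  · rw [abs_of_nonneg (rpow_nonneg hq0.le _)]
    exact rpow_lt_one hq0.le hq1 hx
  · have : 1 - q ^ (k + 1) ≠ 0 := (sub_pos.2 (pow_lt_one₀ hq0.le hq1 (by simp))).ne'
    rw [rpow_succ_mul_eq_pow hq0, rpow_succ_mul_eq_pow hq0, rpow_add hq0, rpow_one, mul_pow]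
    field_simp

/-- The elementary inequality `1 - 1/s < log s < s - 1` at `s = q^{(k+1)/2}`, rescaled to compare
the `k`-th terms of `qLogSeries` and `qDigamma`. -/
lemma qLogSeries_term_bounds {q : ℝ} (hq0 : 0 < q) (hq1 : q < 1) (x : ℝ) (k : ℕ) :
    1 / 2 * log q * (q ^ (((k : ℝ) + 1) * (x + 1 / 2)) / (1 - q ^ (k + 1))) <
      q ^ (((k : ℝ) + 1) * (x + 1)) / (((k : ℝ) + 1) * (1 - q ^ (k + 1))) -
        q ^ (((k : ℝ) + 1) * (x + 1 / 2)) / (((k : ℝ) + 1) * (1 - q ^ (k + 1))) ∧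
    q ^ (((k : ℝ) + 1) * (x + 1)) / (((k : ℝ) + 1) * (1 - q ^ (k + 1))) -
        q ^ (((k : ℝ) + 1) * (x + 1 / 2)) / (((k : ℝ) + 1) * (1 - q ^ (k + 1))) <
      1 / 2 * log q * (q ^ (((k : ℝ) + 1) * (x + 1)) / (1 - q ^ (k + 1))) := by
  have hd : 0 < 1 - q ^ (k + 1) := sub_pos.2 (pow_lt_one₀ hq0.le hq1 (by simp))
  have hk : (0 : ℝ) < (k : ℝ) + 1 := by positivity
  set s : ℝ := q ^ (((k : ℝ) + 1) * (1 / 2)) with hs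
  set a : ℝ := q ^ (((k : ℝ) + 1) * (x + 1 / 2)) with ha
  have hs0 : 0 < s := rpow_pos_of_pos hq0 _
  have ha0 : 0 < a := rpow_pos_of_pos hq0 _
  have hs1 : s < 1 := rpow_lt_one hq0.le hq1 (by positivity)
  have hlogs : log s = ((k : ℝ) + 1) * (1 / 2) * log q := log_rpow hq0 _
  have hb : q ^ (((k : ℝ) + 1) * (x + 1)) = a * s := by
    rw [ha, hs, ← rpow_add hq0]
    congr 1
    ring
  have hu : log s < s - 1 := log_lt_sub_one_of_pos hs0 hs1.ne
  have hl : s - 1 < s * log s := by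
    have h := log_lt_sub_one_of_pos (inv_pos.2 hs0) (inv_ne_one.2 hs1.ne)
    rw [log_inv] at h
    have h' := mul_lt_mul_of_pos_left h hs0
    rw [mul_sub, mul_inv_cancel₀ hs0.ne'] at h'
    linarith
  have hc : 0 < a / (((k : ℝ) + 1) * (1 - q ^ (k + 1))) := by positivity
  rw [hb]
  constructor
  · calc _ = a / (((k : ℝ) + 1) * (1 - q ^ (k + 1))) * log s := by rw [hlogs]; field_simp
      _ < a / (((k : ℝ) + 1) * (1 - q ^ (k + 1))) * (s - 1) := by gcongr
      _ = _ := by ring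
  · calc _ = a / (((k : ℝ) + 1) * (1 - q ^ (k + 1))) * (s - 1) := by ring
      _ < a / (((k : ℝ) + 1) * (1 - q ^ (k + 1))) * (s * log s) := by gcongr
      _ = _ := by rw [hlogs]; field_simp

lemma qGamma_div_qGamma_add_half {q x : ℝ} (hq0 : 0 < q) (hq1 : q < 1) (hx : 0 < x) :
    qGamma q x / qGamma q (x + 1 / 2) =
      (1 - q) / (1 - q ^ x) *
        exp (1 / 2 * -log (1 - q) + (qLogSeries q (x + 1) - qLogSeries q (x + 1 / 2))) := by
  have h1q : 0 < 1 - q := sub_pos.2 hq1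
  have h1qx : 0 < 1 - q ^ x := sub_pos.2 (rpow_lt_one hq0.le hq1 hx)
  rw [qGamma_eq_exp_s6 hq0 hq1 hx, qGamma_eq_exp_s6 hq0 hq1 (add_pos hx one_half_pos),
    rpow_def_of_pos h1q, rpow_def_of_pos h1q, ← exp_add, ← exp_add, ← exp_sub]
  nth_rewrite 3 [← exp_log h1q]
  nth_rewrite 1 [← exp_log h1qx]
  rw [← exp_sub, ← exp_add]
  congr 1
  linear_combination qLogSeries_sub_qLogSeries_add_one hq0 hq1 hx

theorem qGamma_ratio_exp_bounds_half' (q x : ℝ) (hq0 : 0 < q) (hq1 : q < 1) (hx : 0 < x) :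
    ((1 - q) / (1 - q ^ x)) * Real.exp ((1/2) * qDigamma q (x + 1/2)) <
      qGamma q x / qGamma q (x + 1/2) ∧
    qGamma q x / qGamma q (x + 1/2) <
      ((1 - q) / (1 - q ^ x)) * Real.exp ((1/2) * qDigamma q (x + 1)) := by
  have hc : 0 < (1 - q) / (1 - q ^ x) :=
    div_pos (sub_pos.2 hq1) (sub_pos.2 (rpow_lt_one hq0.le hq1 hx))
  have hx₁ : 0 < x + 1 := by positivity
  have hx₂ : 0 < x + 1 / 2 := by positivity
  have hS := (hasSum_qLogSeries hq0 hq1 hx₁).sub (hasSum_qLogSeries hq0 hq1 hx₂)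
  have hlower := hasSum_strict_mono
    ((summable_qDigamma hq0 hq1 hx₂).hasSum.mul_left (1 / 2 * log q)) hS
    (Pi.lt_def.2 ⟨fun k => (qLogSeries_term_bounds hq0 hq1 x k).1.le,
      0, (qLogSeries_term_bounds hq0 hq1 x 0).1⟩)
  have hupper := hasSum_strict_mono hS
    ((summable_qDigamma hq0 hq1 hx₁).hasSum.mul_left (1 / 2 * log q))
    (Pi.lt_def.2 ⟨fun k => (qLogSeries_term_bounds hq0 hq1 x k).2.le,
      0, (qLogSeries_term_bounds hq0 hq1 x 0).2⟩)
  rw [qGamma_div_qGamma_add_half hq0 hq1 hx, qDigamma, qDigamma]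
  constructor <;> gcongr <;> linarith
end
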